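/- The bivariate generating function L(z,w) of ℓ-periodic dissections satisfies the functional equation L = 1 + w·z·L^2/(1 - z^ℓ·L^ℓ) as formal power series. -/

import Mathlib

/-! A combinatorial model of dissections of a convex `N`-gon.
Vertices are `Fin N` in cyclic (convex position) order.  A dissection is
recorded by its set of pairwise non-crossing diagonals; its cells are the
faces of the resulting subdivision. -/

namespace PolygonDissection

/-- The cyclic successor of a vertex of the `N`-gon. -/
def cyc {N : ℕ} (i : Fin N) : Fin N := ⟨(i.val + 1) % N, Nat.mod_lt _ i.pos⟩

/-- `e` is a side of the convex `N`-gon: a pair of cyclically adjacent vertices. -/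
def IsSide (N : ℕ) (e : Finset (Fin N)) : Prop :=
  ∃ i : Fin N, i ≠ cyc i ∧ e = {i, cyc i}

/-- `e` is a diagonal of the convex `N`-gon. -/
def IsDiag (N : ℕ) (e : Finset (Fin N)) : Prop :=
  e.card = 2 ∧ ¬ IsSide N e

/-- Two chords of the convex `N`-gon cross in the interior. -/
def Crosses (N : ℕ) (e f : Finset (Fin N)) : Prop :=
  ∃ a b c d : Fin N, a < c ∧ c < b ∧ b < d ∧
    ((e = {a, b} ∧ f = {c, d}) ∨ (e = {c, d} ∧ f = {a, b}))

/-- A dissection of the convex `N`-gon: a set of pairwise non-crossing diagonals. -/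
def IsDissection (N : ℕ) (S : Finset (Finset (Fin N))) : Prop :=
  (∀ e ∈ S, IsDiag N e) ∧ ∀ e ∈ S, ∀ f ∈ S, ¬ Crosses N e f

/-- `y` is the cyclic successor of `x` among the vertices of `c`. -/
def IsNext {N : ℕ} (c : Finset (Fin N)) (x y : Fin N) : Prop :=
  x ∈ c ∧ y ∈ c ∧ y ≠ x ∧ ∀ z ∈ c, z ≠ x → (y - x).val ≤ (z - x).val

/-- `c` (a set of polygon vertices) is a cell of the dissection `S`:
each pair of cyclically consecutive vertices of `c` is joined by a side of the
polygon or a diagonal of `S`, and no diagonal of `S` is an interior chord of `c`. -/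
def IsCell (N : ℕ) (S : Finset (Finset (Fin N))) (c : Finset (Fin N)) : Prop :=
  3 ≤ c.card ∧
  (∀ x y : Fin N, IsNext c x y → IsSide N {x, y} ∨ {x, y} ∈ S) ∧
  (∀ e ∈ S, e ⊆ c → ∃ x y, e = ({x, y} : Finset (Fin N)) ∧ (IsNext c x y ∨ IsNext c y x))

/-- The number of cells of the dissection `S`. -/
noncomputable def numCells (N : ℕ) (S : Finset (Finset (Fin N))) : ℕ :=
  {c : Finset (Fin N) | IsCell N S c}.ncard

/-- The quiddity of the dissection `S`: its `i`-th entry is the number of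
cells containing the `i`-th vertex. -/
noncomputable def quiddity (N : ℕ) (S : Finset (Finset (Fin N))) (i : Fin N) : ℕ :=
  {c : Finset (Fin N) | IsCell N S c ∧ i ∈ c}.ncard


/-- `Lnm ℓ n m` is the number of `ℓ`-periodic dissections (every cell has size
`≡ 3 mod ℓ`) of a convex `(n+2)`-gon into `m` cells. -/
noncomputable def Lnm (ℓ n m : ℕ) : ℕ :=
  {S : Finset (Finset (Fin (n + 2))) | IsDissection (n + 2) S ∧
      (∀ c : Finset (Fin (n + 2)), IsCell (n + 2) S c → c.card % ℓ = 3 % ℓ) ∧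
      numCells (n + 2) S = m}.ncard

/-- The bivariate generating function `L(z, w) = ∑ Lnm ℓ n m * z^n * w^m`. -/
noncomputable def Lgf (ℓ : ℕ) : MvPowerSeries (Fin 2) ℚ :=
  fun d => (Lnm ℓ (d 0) (d 1) : ℚ)

section GFpart
open MvPowerSeries

/-- fibre counting generating function -/
noncomputable def gf {X : Type} (f : X → (Fin 2 →₀ ℕ)) : MvPowerSeries (Fin 2) ℚ :=
  fun d => (Nat.card {x // f x = d} : ℚ)

theorem coeff_gf {X : Type} (f : X → (Fin 2 →₀ ℕ)) (d) :
    coeff d (gf f) = (Nat.card {x // f x = d} : ℚ) := rfl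

theorem gf_equiv {X Y : Type} (f : X → (Fin 2 →₀ ℕ)) (g : Y → (Fin 2 →₀ ℕ)) (e : X ≃ Y)
    (h : ∀ x, g (e x) = f x) : gf f = gf g := by
  ext d
  rw [coeff_gf, coeff_gf]
  congr 1
  exact Nat.card_congr (e.subtypeEquiv (fun x => by rw [h]))

theorem gf_unit (a : Fin 2 →₀ ℕ) : gf (fun _ : Unit => a) = monomial a (1 : ℚ) := by
  classical
  ext d
  rw [coeff_gf, coeff_monomial]
  split_ifs with h
  · subst h
    simp
  · have : IsEmpty {x : Unit // a = d} := ⟨fun x => h x.2.symm⟩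
    simp

theorem gf_sum {X Y : Type} (f : X → (Fin 2 →₀ ℕ)) (g : Y → (Fin 2 →₀ ℕ))
    (hf : ∀ d, Finite {x // f x = d}) (hg : ∀ d, Finite {x // g x = d}) :
    gf (Sum.elim f g) = gf f + gf g := by
  ext d
  rw [map_add, coeff_gf, coeff_gf, coeff_gf, ← Nat.cast_add]
  have := hf d
  have := hg d
  rw [← Nat.card_sum]
  congr 1
  exact Nat.card_congr (Equiv.subtypeSum)

theorem gf_prod {X Y : Type} (f : X → (Fin 2 →₀ ℕ)) (g : Y → (Fin 2 →₀ ℕ))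
    (hf : ∀ d, Finite {x // f x = d}) (hg : ∀ d, Finite {x // g x = d}) :
    gf (fun x : X × Y => f x.1 + g x.2) = gf f * gf g := by
  classical
  ext d
  rw [coeff_mul, coeff_gf]
  simp only [coeff_gf, ← Nat.cast_mul, ← Nat.cast_sum]
  congr 1
  have e : {x : X × Y // f x.1 + g x.2 = d} ≃
      Σ p : Finset.HasAntidiagonal.antidiagonal d, {x // f x = p.1.1} × {y // g y = p.1.2} :=
    { toFun := fun x => ⟨⟨(f x.1.1, g x.1.2), Finset.HasAntidiagonal.mem_antidiagonal.2 x.2⟩, ⟨x.1.1, rfl⟩, ⟨x.1.2, rfl⟩⟩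
      invFun := fun x => ⟨(x.2.1.1, x.2.2.1), by
        have := x.1.2
        rw [Finset.HasAntidiagonal.mem_antidiagonal] at this
        rw [x.2.1.2, x.2.2.2, this]⟩
      left_inv := fun x => rfl
      right_inv := by
        rintro ⟨⟨⟨a, b⟩, hp⟩, ⟨x, hx⟩, ⟨y, hy⟩⟩
        dsimp at hx hy
        subst hx hy
        rfl }
  rw [Nat.card_congr e]
  have := hf
  have := hg
  rw [Nat.card_sigma]
  simp only [Nat.card_prod]
  rw [Finset.univ_eq_attach, Finset.sum_attach (Finset.HasAntidiagonal.antidiagonal d) (fun p => Nat.card {x // f x = p.1} * Nat.card {y // g y = p.2})]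

end GFpart

/-- vertices of `[i,j]` not strictly covered by an arc of `U` -/
def unc (U : Finset (ℕ × ℕ)) (i j : ℕ) : Finset ℕ :=
  (Finset.Icc i j).filter (fun v => ∀ e ∈ U, ¬ (e.1 < v ∧ v < e.2))

def sub (T : Finset (ℕ × ℕ)) (i j : ℕ) : Finset (ℕ × ℕ) :=
  T.filter (fun e => i ≤ e.1 ∧ e.2 ≤ j ∧ e ≠ (i, j))

def NX (T : Finset (ℕ × ℕ)) : Prop :=
  ∀ i j k l, (i, j) ∈ T → (k, l) ∈ T → i < k → k < j → j < l → False

def NC (n : ℕ) (T : Finset (ℕ × ℕ)) : Prop :=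
  (∀ i j, (i, j) ∈ T → i + 2 ≤ j ∧ j ≤ n) ∧ NX T

def OK (ℓ : ℕ) (T : Finset (ℕ × ℕ)) : Prop :=
  ∀ i j, (i, j) ∈ T → (unc (sub T i j) i j).card % ℓ = 3 % ℓ

theorem mem_unc {U : Finset (ℕ × ℕ)} {i j v : ℕ} : v ∈ unc U i j ↔
    i ≤ v ∧ v ≤ j ∧ ∀ a b, (a, b) ∈ U → a < v → v < b → False := by
  simp only [unc, Finset.mem_filter, Finset.mem_Icc, Prod.forall, not_and, and_assoc]

theorem mem_sub {T : Finset (ℕ × ℕ)} {i j a b : ℕ} : (a, b) ∈ sub T i j ↔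
    (a, b) ∈ T ∧ i ≤ a ∧ b ≤ j ∧ ¬ (a = i ∧ b = j) := by
  simp [sub]

theorem NX_sub {T : Finset (ℕ × ℕ)} (h : NX T) (i j : ℕ) : NX (sub T i j) := by
  intro a b c d h1 h2
  exact h a b c d (mem_sub.1 h1).1 (mem_sub.1 h2).1

theorem gap {U : Finset (ℕ × ℕ)} (hU : NX U) {i j x y : ℕ}
    (hx : x ∈ unc U i j) (hy : y ∈ unc U i j) (hxy : x + 2 ≤ y)
    (hb : ∀ v ∈ unc U i j, x < v → v < y → False) : (x, y) ∈ U := by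
  have hx' := mem_unc.1 hx
  have hy' := mem_unc.1 hy
  have h1 : x + 1 ∉ unc U i j := fun h => hb _ h (by omega) (by omega)
  have h2 : ∃ b, (x, b) ∈ U ∧ x + 1 < b := by
    rw [mem_unc] at h1
    push Not at h1
    obtain ⟨a, b, hab, h3, h4, -⟩ := h1 (by omega) (by omega)
    have : a = x := by
      by_contra hne
      exact hx'.2.2 a b hab (by omega) (by omega)
    subst this
    exact ⟨b, hab, h4⟩
  obtain ⟨b0, hb0, hb0'⟩ := h2
  let B := (U.filter (fun e => e.1 = x)).image Prod.snd
  have memB : ∀ q, q ∈ B ↔ (x, q) ∈ U := by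
    intro q
    simp [B]
  have hne : B.Nonempty := ⟨b0, (memB _).2 hb0⟩
  have hq := B.max'_mem hne
  have hmax : ∀ q ∈ B, q ≤ B.max' hne := fun q hq => B.le_max' q hq
  generalize B.max' hne = q at hq hmax
  rw [memB] at hq
  have hb0q := hmax b0 ((memB _).2 hb0)
  have hqy : q ≤ y := by
    by_contra h
    exact hy'.2.2 x q hq (by omega) (by omega)
  have hqc : q ∈ unc U i j := by
    rw [mem_unc]
    refine ⟨by omega, by omega, ?_⟩
    intro a b hab h1 h2
    rcases lt_trichotomy a x with h | h | h
    · exact hx'.2.2 a b hab h (by omega)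
    · subst h
      have := hmax b ((memB _).2 hab)
      omega
    · exact hU x q a b hq hab h h1 h2
  have : q = y := by
    by_contra h
    exact hb q hqc (by omega) (by omega)
  exact this ▸ hq

/-- translate of an arc set -/
def shift (p : ℕ) (T : Finset (ℕ × ℕ)) : Finset (ℕ × ℕ) :=
  T.image (fun e => (e.1 + p, e.2 + p))

theorem mem_shift {p : ℕ} {T : Finset (ℕ × ℕ)} {a b : ℕ} : (a, b) ∈ shift p T ↔
    p ≤ a ∧ p ≤ b ∧ (a - p, b - p) ∈ T := by
  simp only [shift, Finset.mem_image, Prod.mk.injEq, Prod.exists]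
  constructor
  · rintro ⟨c, d, h, rfl, rfl⟩
    simpa using h
  · rintro ⟨h1, h2, h⟩
    exact ⟨_, _, h, by omega, by omega⟩

theorem mem_shift' {p : ℕ} {T : Finset (ℕ × ℕ)} {a b : ℕ} : (a + p, b + p) ∈ shift p T ↔
    (a, b) ∈ T := by
  simp [mem_shift]

theorem card_shift (p : ℕ) (T : Finset (ℕ × ℕ)) : (shift p T).card = T.card := by
  apply Finset.card_image_of_injective
  rintro ⟨a, b⟩ ⟨c, d⟩ h
  simp at h
  simp [h]

theorem unc_shift (p : ℕ) (U : Finset (ℕ × ℕ)) (i j : ℕ) :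
    unc (shift p U) (i + p) (j + p) = (unc U i j).image (· + p) := by
  ext v
  simp only [Finset.mem_image, mem_unc]
  constructor
  · rintro ⟨h1, h2, h3⟩
    refine ⟨v - p, ⟨by omega, by omega, ?_⟩, by omega⟩
    intro a b hab h4 h5
    exact h3 (a + p) (b + p) (mem_shift'.2 hab) (by omega) (by omega)
  · rintro ⟨u, ⟨h1, h2, h3⟩, rfl⟩
    refine ⟨by omega, by omega, ?_⟩
    intro a b hab h4 h5
    rw [mem_shift] at hab
    exact h3 _ _ hab.2.2 (by omega) (by omega)

theorem card_im (p : ℕ) (s : Finset ℕ) : (s.image (· + p)).card = s.card :=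
  Finset.card_image_of_injective _ (fun a b h => by simpa using h)

theorem NC_glue {p q : ℕ} {T1 T2 : Finset (ℕ × ℕ)} (h1 : NC p T1) (h2 : NC q T2) :
    NC (p + q) (T1 ∪ shift p T2) := by
  constructor
  · intro i j hij
    rw [Finset.mem_union, mem_shift] at hij
    rcases hij with h | h
    · have := h1.1 _ _ h
      omega
    · have := h2.1 _ _ h.2.2
      omega
  · intro a b c d hab hcd l1 l2 l3
    rw [Finset.mem_union, mem_shift] at hab hcd
    rcases hab with h | h <;> rcases hcd with h' | h'
    · exact h1.2 _ _ _ _ h h' l1 l2 l3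
    · have := h1.1 _ _ h
      omega
    · have := h1.1 _ _ h'
      omega
    · exact h2.2 _ _ _ _ h.2.2 h'.2.2 (by omega) (by omega) (by omega)

theorem sub_glue1 {p q : ℕ} {T1 T2 : Finset (ℕ × ℕ)} (h2 : NC q T2) {i j : ℕ} (hj : j ≤ p) :
    sub (T1 ∪ shift p T2) i j = sub T1 i j := by
  ext ⟨a, b⟩
  simp only [mem_sub, Finset.mem_union, mem_shift]
  constructor
  · rintro ⟨h | h, h'⟩
    · exact ⟨h, h'⟩
    · have := h2.1 _ _ h.2.2
      omega
  · rintro ⟨h, h'⟩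
    exact ⟨Or.inl h, h'⟩

theorem sub_glue2 {p : ℕ} {T1 T2 : Finset (ℕ × ℕ)} (h1 : NC p T1) {i j : ℕ} :
    sub (T1 ∪ shift p T2) (i + p) (j + p) = shift p (sub T2 i j) := by
  ext ⟨a, b⟩
  simp only [mem_sub, Finset.mem_union, mem_shift]
  constructor
  · rintro ⟨h | h, h'⟩
    · have := h1.1 _ _ h
      omega
    · exact ⟨h.1, h.2.1, h.2.2, by omega, by omega, by omega⟩
  · rintro ⟨h, h', h'', h3⟩
    exact ⟨Or.inr ⟨h, h', h''⟩, by omega, by omega, by omega⟩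

theorem OK_glue {ℓ p q : ℕ} {T1 T2 : Finset (ℕ × ℕ)} (h1 : NC p T1) (h2 : NC q T2) :
    OK ℓ (T1 ∪ shift p T2) ↔ OK ℓ T1 ∧ OK ℓ T2 := by
  constructor
  · intro h
    constructor
    · intro i j hij
      have := h i j (Finset.mem_union_left _ hij)
      rwa [sub_glue1 h2 (h1.1 _ _ hij).2] at this
    · intro i j hij
      have := h (i + p) (j + p) (Finset.mem_union_right _ (mem_shift'.2 hij))
      rwa [sub_glue2 h1, unc_shift, card_im] at this
  · rintro ⟨g1, g2⟩ i j hij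
    rw [Finset.mem_union] at hij
    rcases hij with h | h
    · rw [sub_glue1 h2 (h1.1 _ _ h).2]
      exact g1 i j h
    · obtain ⟨a, b, rfl, rfl⟩ : ∃ a b, i = a + p ∧ j = b + p :=
        ⟨i - p, j - p, by have := mem_shift.1 h; omega, by have := mem_shift.1 h; omega⟩
      rw [sub_glue2 h1, unc_shift, card_im]
      exact g2 _ _ (mem_shift'.1 h)

theorem unc_glue {p q : ℕ} {T1 T2 : Finset (ℕ × ℕ)} (h1 : NC p T1) (hp : 1 ≤ p)
    (ht : ∀ v ∈ unc T1 0 p, v = 0 ∨ v = p) :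
    unc (T1 ∪ shift p T2) 0 (p + q) = insert 0 ((unc T2 0 q).image (· + p)) := by
  ext v
  rw [Finset.mem_insert, Finset.mem_image]
  constructor
  · intro hv
    rw [mem_unc] at hv
    obtain ⟨-, hv, h⟩ := hv
    by_cases hvp : v < p
    · left
      have : v ∈ unc T1 0 p := by
        rw [mem_unc]
        exact ⟨by omega, by omega, fun a b hab => h a b (Finset.mem_union_left _ hab)⟩
      rcases ht v this with h | h
      · exact h
      · omega
    · right
      refine ⟨v - p, ?_, by omega⟩
      rw [mem_unc]
      refine ⟨by omega, by omega, fun a b hab l1 l2 => ?_⟩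
      exact h (a + p) (b + p) (Finset.mem_union_right _ (mem_shift'.2 hab)) (by omega) (by omega)
  · rintro (rfl | ⟨u, hu, rfl⟩)
    · rw [mem_unc]
      exact ⟨le_rfl, by omega, fun a b _ l => by omega⟩
    · rw [mem_unc] at hu ⊢
      refine ⟨by omega, by omega, fun a b hab l1 l2 => ?_⟩
      rw [Finset.mem_union, mem_shift] at hab
      rcases hab with h | h
      · have := h1.1 _ _ h
        omega
      · exact hu.2.2 _ _ h.2.2 (by omega) (by omega)

theorem card_unc_glue {p q : ℕ} {T1 T2 : Finset (ℕ × ℕ)} (h1 : NC p T1) (hp : 1 ≤ p)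
    (ht : ∀ v ∈ unc T1 0 p, v = 0 ∨ v = p) :
    (unc (T1 ∪ shift p T2) 0 (p + q)).card = (unc T2 0 q).card + 1 := by
  rw [unc_glue h1 hp ht, Finset.card_insert_of_notMem, card_im]
  simp
  omega

theorem zero_mem_unc {T : Finset (ℕ × ℕ)} {n : ℕ} : 0 ∈ unc T 0 n :=
  mem_unc.2 ⟨le_rfl, by omega, fun a b _ l => by omega⟩

theorem last_mem_unc {T : Finset (ℕ × ℕ)} {n : ℕ} (h : NC n T) : n ∈ unc T 0 n :=
  mem_unc.2 ⟨by omega, le_rfl, fun a b hab l l' => by have := h.1 _ _ hab; omega⟩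

theorem unc_zero {T : Finset (ℕ × ℕ)} : (unc T 0 0) = {0} := by
  ext v
  rw [Finset.mem_singleton]
  constructor
  · intro h
    have := mem_unc.1 h
    omega
  · rintro rfl
    exact zero_mem_unc

theorem pos_of_card {T : Finset (ℕ × ℕ)} {n : ℕ} (h : 2 ≤ (unc T 0 n).card) : 1 ≤ n := by
  by_contra hn
  have : n = 0 := by omega
  subst this
  rw [unc_zero] at h
  simp at h

theorem unc_two {T : Finset (ℕ × ℕ)} {n : ℕ} (h : NC n T) :
    (unc T 0 n).card = 2 ↔ 1 ≤ n ∧ ∀ v ∈ unc T 0 n, v = 0 ∨ v = n := by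
  constructor
  · intro hc
    have hn := pos_of_card hc.ge
    refine ⟨hn, ?_⟩
    have : ({0, n} : Finset ℕ) = unc T 0 n := by
      apply Finset.eq_of_subset_of_card_le
      · intro v hv
        simp at hv
        rcases hv with rfl | rfl
        · exact zero_mem_unc
        · exact last_mem_unc h
      · rw [hc, Finset.card_pair (by omega)]
    intro v hv
    rw [← this] at hv
    simpa using hv
  · rintro ⟨hn, hv⟩
    have : unc T 0 n = ({0, n} : Finset ℕ) := by
      ext v
      simp only [Finset.mem_insert, Finset.mem_singleton]
      refine ⟨hv v, ?_⟩
      rintro (rfl | rfl)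
      · exact zero_mem_unc
      · exact last_mem_unc h
    rw [this, Finset.card_pair (by omega)]

theorem unc_two' {T : Finset (ℕ × ℕ)} {n : ℕ} (h : NC n T) :
    (unc T 0 n).card = 2 ↔ n = 1 ∨ (0, n) ∈ T := by
  rw [unc_two h]
  constructor
  · rintro ⟨hn, hv⟩
    by_cases h1 : n = 1
    · exact Or.inl h1
    · right
      refine gap h.2 (zero_mem_unc) (last_mem_unc h) (by omega) ?_
      intro v hv' h1 h2
      have := hv v hv'
      omega
  · rintro (rfl | h0)
    · refine ⟨le_rfl, fun v hv => ?_⟩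
      have := mem_unc.1 hv
      omega
    · have := h.1 _ _ h0
      refine ⟨by omega, fun v hv => ?_⟩
      have hv := mem_unc.1 hv
      by_contra hc
      exact hv.2.2 _ _ h0 (by omega) (by omega)

/-- dissected paths whose top path has a number of vertices in `A` -/
def Obj (ℓ : ℕ) (A : Set ℕ) : Type :=
  {x : ℕ × Finset (ℕ × ℕ) // NC x.1 x.2 ∧ OK ℓ x.2 ∧ (unc x.2 0 x.1).card ∈ A}

noncomputable def wt {ℓ : ℕ} {A : Set ℕ} (x : Obj ℓ A) : Fin 2 →₀ ℕ :=
  Finsupp.single 0 x.1.1 + Finsupp.single 1 x.1.2.card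

theorem wt_eq {ℓ : ℕ} {A : Set ℕ} (x : Obj ℓ A) (d : Fin 2 →₀ ℕ) :
    wt x = d ↔ x.1.1 = d 0 ∧ x.1.2.card = d 1 := by
  rw [Finsupp.ext_iff, Fin.forall_fin_two]
  simp [wt]

theorem fin_wt {ℓ : ℕ} {A : Set ℕ} (d : Fin 2 →₀ ℕ) : Finite {x : Obj ℓ A // wt x = d} := by
  let B : Finset (Finset (ℕ × ℕ)) := (Finset.range (d 0 + 1) ×ˢ Finset.range (d 0 + 1)).powerset
  apply Finite.of_injective (β := B) (fun x => ⟨x.1.1.2, by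
    simp only [B, Finset.mem_powerset]
    rintro ⟨a, b⟩ hab
    have h1 := x.1.2.1.1 a b hab
    have h2 := (wt_eq _ _).1 x.2
    simp only [Finset.mem_product, Finset.mem_range]
    omega⟩)
  rintro ⟨⟨⟨n, T⟩, h⟩, h1⟩ ⟨⟨⟨n', T'⟩, h'⟩, h1'⟩ hh
  have h2 := (wt_eq _ _).1 h1
  have h2' := (wt_eq _ _).1 h1'
  dsimp at h2 h2'
  simp at hh
  apply Subtype.ext
  apply Subtype.ext
  simp [hh, h2, h2']

def glue {ℓ : ℕ} {A : Set ℕ} (x : Obj ℓ {2} × Obj ℓ A) : Obj ℓ {k | ∃ a ∈ A, k = a + 1} :=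
  ⟨(x.1.1.1 + x.2.1.1, x.1.1.2 ∪ shift x.1.1.1 x.2.1.2),
    NC_glue x.1.2.1 x.2.2.1, (OK_glue x.1.2.1 x.2.2.1).2 ⟨x.1.2.2.1, x.2.2.2.1⟩, by
      have h := (unc_two x.1.2.1).1 x.1.2.2.2
      exact ⟨_, x.2.2.2.2, card_unc_glue x.1.2.1 h.1 h.2⟩⟩

theorem wt_glue {ℓ : ℕ} {A : Set ℕ} (x : Obj ℓ {2} × Obj ℓ A) :
    wt (glue x) = wt x.1 + wt x.2 := by
  rw [wt_eq]
  simp only [wt, glue]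
  constructor
  · simp
  · rw [Finset.card_union_of_disjoint, card_shift]
    · simp
    · rw [Finset.disjoint_left]
      rintro ⟨a, b⟩ h1 h2
      have := x.1.2.1.1 _ _ h1
      rw [mem_shift] at h2
      omega

theorem glue_inj {ℓ : ℕ} {A : Set ℕ} : Function.Injective (glue (ℓ := ℓ) (A := A)) := by
  rintro ⟨⟨⟨p, T1⟩, h1⟩, ⟨⟨q, T2⟩, h2⟩⟩ ⟨⟨⟨p', T1'⟩, h1'⟩, ⟨⟨q', T2'⟩, h2'⟩⟩ h
  have h := congrArg Subtype.val h
  simp only [glue, Prod.mk.injEq] at h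
  obtain ⟨e1, e2⟩ := h
  dsimp only at h1 h2 h1' h2'
  have g := (unc_two h1.1).1 h1.2.2
  have g' := (unc_two h1'.1).1 h1'.2.2
  have u := unc_glue (T2 := T2) (q := q) h1.1 g.1 g.2
  have u' := unc_glue (T2 := T2') (q := q') h1'.1 g'.1 g'.2
  rw [e1, e2, u'] at u
  have a1 : p ∈ insert 0 (Finset.image (· + p') (unc T2' 0 q')) := by
    rw [u]
    exact Finset.mem_insert_of_mem (Finset.mem_image.2 ⟨0, zero_mem_unc, by simp⟩)
  have a2 : p' ∈ insert 0 (Finset.image (· + p) (unc T2 0 q)) := by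
    rw [← u]
    exact Finset.mem_insert_of_mem (Finset.mem_image.2 ⟨0, zero_mem_unc, by simp⟩)
  simp only [Finset.mem_insert, Finset.mem_image] at a1 a2
  have hpp : p = p' := by
    rcases a1 with a1 | ⟨_, -, a1⟩ <;> rcases a2 with a2 | ⟨_, -, a2⟩ <;> omega
  subst hpp
  have hqq : q = q' := by omega
  subst hqq
  have hT : ∀ a b, ((a, b) ∈ T1 ∨ (a, b) ∈ shift p T2) ↔ ((a, b) ∈ T1' ∨ (a, b) ∈ shift p T2') := by
    intro a b
    rw [← Finset.mem_union, e2, Finset.mem_union]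
  have t1 : T1 = T1' := by
    ext ⟨a, b⟩
    constructor
    · intro h
      have l := h1.1.1 _ _ h
      rcases (hT a b).1 (Or.inl h) with h | h
      · exact h
      · rw [mem_shift] at h
        omega
    · intro h
      have l := h1'.1.1 _ _ h
      rcases (hT a b).2 (Or.inl h) with h | h
      · exact h
      · rw [mem_shift] at h
        omega
  have t2 : T2 = T2' := by
    ext ⟨a, b⟩
    constructor
    · intro h
      rcases (hT (a + p) (b + p)).1 (Or.inr (mem_shift'.2 h)) with h | h
      · have l := h1'.1.1 _ _ h
        omega
      · exact mem_shift'.1 h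
    · intro h
      rcases (hT (a + p) (b + p)).2 (Or.inr (mem_shift'.2 h)) with h | h
      · have l := h1.1.1 _ _ h
        omega
      · exact mem_shift'.1 h
  subst t1 t2
  rfl

theorem glue_surj {ℓ : ℕ} {A : Set ℕ} (hA : 0 ∉ A) :
    Function.Surjective (glue (ℓ := ℓ) (A := A)) := by
  rintro ⟨⟨n, T⟩, hT, hO, ⟨k, hk, hc⟩⟩
  dsimp only at hT hO hc
  have hk0 : k ≠ 0 := fun h => hA (h ▸ hk)
  have hn : 1 ≤ n := pos_of_card (by rw [hc]; omega)
  have hne : ((unc T 0 n).erase 0).Nonempty :=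
    ⟨n, Finset.mem_erase.2 ⟨by omega, last_mem_unc hT⟩⟩
  have hp := Finset.min'_mem _ hne
  have hmin : ∀ q ∈ (unc T 0 n).erase 0, ((unc T 0 n).erase 0).min' hne ≤ q :=
    fun q hq => Finset.min'_le ((unc T 0 n).erase 0) q hq
  generalize Finset.min' _ hne = p at hp hmin
  rw [Finset.mem_erase] at hp
  obtain ⟨hp0, hp⟩ := hp
  have hp' := mem_unc.1 hp
  let T1 := T.filter (fun e => e.2 ≤ p)
  let T2 := (T.filter (fun e => p ≤ e.1)).image (fun e => (e.1 - p, e.2 - p))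
  have m1 : ∀ a b, (a, b) ∈ T1 ↔ (a, b) ∈ T ∧ b ≤ p := by
    intro a b
    simp [T1]
  have m2 : ∀ a b, (a, b) ∈ T2 ↔ (a + p, b + p) ∈ T := by
    intro a b
    simp only [T2, Finset.mem_image, Finset.mem_filter, Prod.exists, Prod.mk.injEq]
    constructor
    · rintro ⟨c, d, ⟨h1, h2⟩, rfl, rfl⟩
      have := hT.1 _ _ h1
      rwa [Nat.sub_add_cancel h2, Nat.sub_add_cancel (by omega)]
    · intro h
      exact ⟨_, _, ⟨h, by omega⟩, by omega, by omega⟩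
  have hU : T1 ∪ shift p T2 = T := by
    ext ⟨a, b⟩
    rw [Finset.mem_union, m1, mem_shift, m2]
    constructor
    · rintro (h | ⟨h1, h2, h3⟩)
      · exact h.1
      · rwa [Nat.sub_add_cancel h1, Nat.sub_add_cancel h2] at h3
    · intro h
      have l := hT.1 _ _ h
      by_cases hb : b ≤ p
      · exact Or.inl ⟨h, hb⟩
      · right
        by_cases ha : p ≤ a
        · refine ⟨ha, by omega, ?_⟩
          rwa [Nat.sub_add_cancel ha, Nat.sub_add_cancel (by omega)]
        · exact (hp'.2.2 a b h (by omega) (by omega)).elim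
  have n1 : NC p T1 := by
    constructor
    · intro i j h
      have := (m1 i j).1 h
      have := hT.1 _ _ this.1
      omega
    · intro a b c d h1 h2
      exact hT.2 a b c d ((m1 _ _).1 h1).1 ((m1 _ _).1 h2).1
  have n2 : NC (n - p) T2 := by
    constructor
    · intro i j h
      have := hT.1 _ _ ((m2 i j).1 h)
      omega
    · intro a b c d h1 h2 l1 l2 l3
      exact hT.2 _ _ _ _ ((m2 _ _).1 h1) ((m2 _ _).1 h2) (by omega) (by omega) (by omega)
  have hv : ∀ v ∈ unc T1 0 p, v = 0 ∨ v = p := by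
    intro v hv
    rw [mem_unc] at hv
    by_contra hcon
    have : v ∈ (unc T 0 n).erase 0 := by
      rw [Finset.mem_erase, mem_unc]
      refine ⟨by omega, by omega, by omega, fun a b hab l1 l2 => ?_⟩
      by_cases hb : b ≤ p
      · exact hv.2.2 a b ((m1 _ _).2 ⟨hab, hb⟩) l1 l2
      · exact hp'.2.2 a b hab (by omega) (by omega)
    have := hmin v this
    omega
  have hOO := (OK_glue (ℓ := ℓ) n1 n2).1 (by rwa [hU])
  have hcard := card_unc_glue (T2 := T2) (q := n - p) n1 (by omega) hv
  have hnp : p + (n - p) = n := by omega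
  rw [hU, hnp, hc] at hcard
  refine ⟨⟨⟨(p, T1), n1, hOO.1, (unc_two n1).2 ⟨by omega, hv⟩⟩,
    ⟨(n - p, T2), n2, hOO.2, ?_⟩⟩, ?_⟩
  · have : (unc T2 0 (n - p)).card = k := by omega
    dsimp only
    rw [this]
    exact hk
  · apply Subtype.ext
    simp only [glue]
    rw [hU, hnp]

theorem gf_glue (ℓ : ℕ) (A : Set ℕ) (hA : 0 ∉ A) :
    gf (wt (ℓ := ℓ) (A := {k | ∃ a ∈ A, k = a + 1})) =
      gf (wt (ℓ := ℓ) (A := {2})) * gf (wt (ℓ := ℓ) (A := A)) := by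
  rw [← gf_prod _ _ fin_wt fin_wt]
  symm
  exact gf_equiv _ _ (Equiv.ofBijective glue ⟨glue_inj, glue_surj hA⟩) wt_glue

theorem gf_glue_pow (ℓ : ℕ) (A : Set ℕ) (hA : 0 ∉ A) (r : ℕ) :
    gf (wt (ℓ := ℓ) (A := {k | ∃ a ∈ A, k = a + r})) =
      gf (wt (ℓ := ℓ) (A := {2})) ^ r * gf (wt (ℓ := ℓ) (A := A)) := by
  induction r with
  | zero =>
    have : {k | ∃ a ∈ A, k = a + 0} = A := by ext; simp
    rw [this]
    simp
  | succ r ih =>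
    have : {k | ∃ a ∈ A, k = a + (r + 1)} = {k | ∃ b ∈ {k | ∃ a ∈ A, k = a + r}, k = b + 1} := by
      ext k
      simp [add_assoc]
    rw [this, gf_glue, ih]
    · ring
    · rintro ⟨a, ha, h⟩
      have : a = 0 := by omega
      exact hA (this ▸ ha)

theorem gf_one (ℓ : ℕ) : gf (wt (ℓ := ℓ) (A := {1})) = 1 := by
  have h0 : NC 0 ∅ := ⟨by simp, by intro a b c d h; simp at h⟩
  let o : Obj ℓ {1} := ⟨(0, ∅), h0, by intro i j h; simp at h, by dsimp only; rw [unc_zero]; rfl⟩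
  have ho : ∀ x : Obj ℓ {1}, x = o := by
    rintro ⟨⟨n, T⟩, hT, hO, hc⟩
    apply Subtype.ext
    dsimp only at hT hO hc
    have hc : (unc T 0 n).card = 1 := hc
    have : n = 0 := Finset.card_le_one.1 hc.le _ (last_mem_unc hT) _ zero_mem_unc
    subst this
    have : T = ∅ := by
      rw [Finset.eq_empty_iff_forall_notMem]
      rintro ⟨a, b⟩ h
      have := hT.1 _ _ h
      omega
    subst this
    rfl
  rw [gf_equiv _ (fun _ : Unit => (0 : Fin 2 →₀ ℕ)) ⟨fun _ => (), fun _ => o, fun x => (ho x).symm, fun _ => rfl⟩, gf_unit]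
  · rfl
  · intro x
    rw [ho x]
    symm
    rw [wt_eq]
    simp [o]

theorem gf_union (ℓ : ℕ) (A B : Set ℕ) (h : Disjoint A B) :
    gf (wt (ℓ := ℓ) (A := A ∪ B)) = gf (wt (ℓ := ℓ) (A := A)) + gf (wt (ℓ := ℓ) (A := B)) := by
  rw [← gf_sum _ _ fin_wt fin_wt]
  symm
  let f : Obj ℓ A ⊕ Obj ℓ B → Obj ℓ (A ∪ B) := Sum.elim
    (fun x => ⟨x.1, x.2.1, x.2.2.1, Or.inl x.2.2.2⟩)
    (fun x => ⟨x.1, x.2.1, x.2.2.1, Or.inr x.2.2.2⟩)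
  have hf : Function.Bijective f := by
    constructor
    · rintro (⟨x, hx⟩ | ⟨x, hx⟩) (⟨y, hy⟩ | ⟨y, hy⟩) hxy
      · have := congrArg Subtype.val hxy
        dsimp [f] at this
        subst this
        rfl
      · have := congrArg Subtype.val hxy
        dsimp [f] at this
        subst this
        exact (Set.disjoint_left.1 h hx.2.2 hy.2.2).elim
      · have := congrArg Subtype.val hxy
        dsimp [f] at this
        subst this
        exact (Set.disjoint_left.1 h hy.2.2 hx.2.2).elim
      · have := congrArg Subtype.val hxy
        dsimp [f] at this
        subst this
        rfl
    · rintro ⟨x, h1, h2, h3 | h3⟩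
      · exact ⟨Sum.inl ⟨x, h1, h2, h3⟩, rfl⟩
      · exact ⟨Sum.inr ⟨x, h1, h2, h3⟩, rfl⟩
  exact gf_equiv _ _ (Equiv.ofBijective f hf) (by rintro (x | x) <;> rfl)

def A3 (ℓ : ℕ) : Set ℕ := {k | 3 ≤ k ∧ k % ℓ = 3 % ℓ}

theorem gf_A3 (ℓ : ℕ) (hℓ : 1 ≤ ℓ) : gf (wt (ℓ := ℓ) (A := A3 ℓ)) =
    gf (wt (ℓ := ℓ) (A := {2})) ^ 2 +
      gf (wt (ℓ := ℓ) (A := {2})) ^ ℓ * gf (wt (ℓ := ℓ) (A := A3 ℓ)) := by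
  have e : A3 ℓ = {k | ∃ a ∈ ({1} : Set ℕ), k = a + 2} ∪ {k | ∃ a ∈ A3 ℓ, k = a + ℓ} := by
    ext k
    simp only [A3, Set.mem_union, Set.mem_ofPred_eq, Set.mem_singleton_iff, exists_eq_left]
    constructor
    · rintro ⟨h1, h2⟩
      by_cases h3 : k = 3
      · left; omega
      · right
        have h4 : ℓ ∣ k - 3 := (Nat.modEq_iff_dvd' h1).1 h2.symm
        have h5 := Nat.le_of_dvd (by omega) h4
        refine ⟨k - ℓ, ⟨by omega, ?_⟩, by omega⟩
        rw [← h2]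
        conv_rhs => rw [← Nat.sub_add_cancel (show ℓ ≤ k by omega)]
        simp
    · rintro (rfl | ⟨a, ⟨h1, h2⟩, rfl⟩)
      · simp
      · exact ⟨by omega, by simpa using h2⟩
  conv_lhs => rw [e]
  rw [gf_union, gf_glue_pow, gf_glue_pow, gf_one, mul_one]
  · rintro ⟨h, -⟩; omega
  · simp
  · rw [Set.disjoint_left]
    rintro k ⟨a, ha, rfl⟩ ⟨b, hb, h⟩
    have := hb.1
    simp at ha
    omega

theorem sub_insert {n : ℕ} {T : Finset (ℕ × ℕ)} (hT : NC n T) {i j : ℕ} (hij : (i, j) ∈ T) :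
    sub (insert (0, n) T) i j = sub T i j := by
  ext ⟨a, b⟩
  have := hT.1 _ _ hij
  simp only [mem_sub, Finset.mem_insert, Prod.mk.injEq]
  constructor
  · rintro ⟨⟨rfl, rfl⟩ | h, h'⟩
    · omega
    · exact ⟨h, h'⟩
  · rintro ⟨h, h'⟩
    exact ⟨Or.inr h, h'⟩

theorem sub_insert' {n : ℕ} {T : Finset (ℕ × ℕ)} (hT : NC n T) (h0 : (0, n) ∉ T) :
    sub (insert (0, n) T) 0 n = T := by
  ext ⟨a, b⟩
  simp only [mem_sub, Finset.mem_insert, Prod.mk.injEq]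
  constructor
  · rintro ⟨⟨rfl, rfl⟩ | h, h'⟩
    · omega
    · exact h
  · intro h
    have := hT.1 _ _ h
    refine ⟨Or.inr h, by omega, by omega, ?_⟩
    rintro ⟨rfl, rfl⟩
    exact h0 h

theorem NC_insert {n : ℕ} {T : Finset (ℕ × ℕ)} (hT : NC n T) (hn : 2 ≤ n) :
    NC n (insert (0, n) T) := by
  constructor
  · intro i j h
    rw [Finset.mem_insert, Prod.mk.injEq] at h
    rcases h with ⟨rfl, rfl⟩ | h
    · omega
    · exact hT.1 _ _ h
  · intro a b c d h1 h2 l1 l2 l3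
    simp only [Finset.mem_insert, Prod.mk.injEq] at h1 h2
    rcases h1 with h1 | h1 <;> rcases h2 with h2 | h2
    · omega
    · have := hT.1 _ _ h2
      omega
    · omega
    · exact hT.2 _ _ _ _ h1 h2 l1 l2 l3

theorem big {ℓ : ℕ} (x : Obj ℓ (A3 ℓ)) : 2 ≤ x.1.1 ∧ (0, x.1.1) ∉ x.1.2 := by
  obtain ⟨⟨n, T⟩, hT, hO, hc, -⟩ := x
  dsimp only at hT hc ⊢
  change 3 ≤ (unc T 0 n).card at hc
  have h := unc_two' hT
  have h0 := pos_of_card (T := T) (n := n) (by omega)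
  by_cases h1 : n = 1
  · have := h.2 (Or.inl h1)
    omega
  · refine ⟨by omega, fun h2 => ?_⟩
    have := h.2 (Or.inr h2)
    omega

def addBase {ℓ : ℕ} : Unit ⊕ Unit × Obj ℓ (A3 ℓ) → Obj ℓ {2} := Sum.elim
  (fun _ => ⟨(1, ∅), ⟨by simp, by intro a b c d h; simp at h⟩, by intro i j h; simp at h,
    (unc_two' ⟨by simp, by intro a b c d h; simp at h⟩).2 (Or.inl rfl)⟩)
  (fun x => ⟨(x.2.1.1, insert (0, x.2.1.1) x.2.1.2), NC_insert x.2.2.1 (big x.2).1, by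
    intro i j hij
    dsimp only at hij ⊢
    rw [Finset.mem_insert, Prod.mk.injEq] at hij
    rcases hij with ⟨rfl, rfl⟩ | hij
    · rw [sub_insert' x.2.2.1 (big x.2).2]
      exact x.2.2.2.2.2
    · rw [sub_insert x.2.2.1 hij]
      exact x.2.2.2.1 i j hij,
    (unc_two' (NC_insert x.2.2.1 (big x.2).1)).2 (Or.inr (Finset.mem_insert_self _ _))⟩)

theorem addBase_l {ℓ : ℕ} (x : Unit) : (addBase (ℓ := ℓ) (Sum.inl x)).1 = (1, ∅) := rfl

theorem addBase_r {ℓ : ℕ} (u : Unit) (x : Obj ℓ (A3 ℓ)) :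
    (addBase (ℓ := ℓ) (Sum.inr (u, x))).1 = (x.1.1, insert (0, x.1.1) x.1.2) := rfl

theorem addBase_bij {ℓ : ℕ} : Function.Bijective (addBase (ℓ := ℓ)) := by
  constructor
  · rintro (x | ⟨_, x⟩) (y | ⟨_, y⟩) h
    · rfl
    · have h := congrArg (fun z => z.1.1) h
      have := (big y).1
      simp only [addBase_l, addBase_r] at h
      omega
    · have h := congrArg (fun z => z.1.1) h
      have := (big x).1
      simp only [addBase_l, addBase_r] at h
      omega
    · have h := congrArg (fun z => z.1) h
      have bx := (big x).2
      have bz := (big y).2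
      simp only [addBase_r, Prod.mk.injEq] at h
      obtain ⟨⟨n, T⟩, hx⟩ := x
      obtain ⟨⟨n', T'⟩, hx'⟩ := y
      dsimp only at *
      obtain ⟨rfl, h2⟩ := h
      have : T = T' := by
        rw [← Finset.erase_insert bx, h2, Finset.erase_insert bz]
      subst this
      rfl
  · rintro ⟨⟨n, T⟩, hT, hO, hc⟩
    rcases (unc_two' hT).1 hc with rfl | h0
    · refine ⟨Sum.inl (), ?_⟩
      apply Subtype.ext
      have : T = ∅ := by
        rw [Finset.eq_empty_iff_forall_notMem]
        rintro ⟨a, b⟩ h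
        have := hT.1 _ _ h
        omega
      subst this
      rfl
    · have hTi : insert (0, n) (T.erase (0, n)) = T := Finset.insert_erase h0
      have hN : NC n (T.erase (0, n)) := by
        constructor
        · intro i j h
          exact hT.1 _ _ (Finset.mem_of_mem_erase h)
        · intro a b c d h1 h2
          exact hT.2 _ _ _ _ (Finset.mem_of_mem_erase h1) (Finset.mem_of_mem_erase h2)
      have hn0 : (0, n) ∉ T.erase (0, n) := Finset.notMem_erase _ _
      have l := hT.1 _ _ h0
      have hO' : OK ℓ (T.erase (0, n)) := by
        intro i j hij
        rw [← sub_insert hN hij, hTi]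
        exact hO i j (Finset.mem_of_mem_erase hij)
      have hcc := hO 0 n h0
      rw [← hTi, sub_insert' hN hn0] at hcc
      have h2 : (unc (T.erase (0, n)) 0 n).card ≠ 2 := by
        rw [Ne, unc_two' hN]
        rintro (h | h)
        · omega
        · exact hn0 h
      have h2' : 2 ≤ (unc (T.erase (0, n)) 0 n).card := by
        have : ({0, n} : Finset ℕ) ⊆ unc (T.erase (0, n)) 0 n := by
          intro v hv
          simp at hv
          rcases hv with rfl | rfl
          · exact zero_mem_unc
          · exact last_mem_unc hN
        have := Finset.card_le_card this
        rwa [Finset.card_pair (by omega)] at this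
      have h3 : 3 ≤ (unc (T.erase (0, n)) 0 n).card := by omega
      refine ⟨Sum.inr ((), ⟨(n, T.erase (0, n)), hN, hO', h3, hcc⟩), ?_⟩
      apply Subtype.ext
      exact (addBase_r _ _).trans (Prod.ext rfl hTi)

theorem gf_two (ℓ : ℕ) : gf (wt (ℓ := ℓ) (A := {2})) =
    MvPowerSeries.X 0 + MvPowerSeries.X 1 * gf (wt (ℓ := ℓ) (A := A3 ℓ)) := by
  have h0 : MvPowerSeries.X 0 = gf (fun _ : Unit => Finsupp.single (0 : Fin 2) 1) := by
    rw [gf_unit]; rfl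
  have h1 : MvPowerSeries.X 1 = gf (fun _ : Unit => Finsupp.single (1 : Fin 2) 1) := by
    rw [gf_unit]; rfl
  have fu : ∀ a d : Fin 2 →₀ ℕ, Finite {x : Unit // (fun _ : Unit => a) x = d} := fun a d => inferInstance
  rw [h0, h1, ← gf_prod _ _ (fu _) fin_wt, ← gf_sum _ _ (fu _)]
  · symm
    refine gf_equiv _ _ (Equiv.ofBijective addBase addBase_bij) ?_
    rintro (x | ⟨_, x⟩)
    · rw [wt_eq]
      simp [addBase_l]
    · rw [wt_eq]
      simp [addBase_r, wt, Finset.card_insert_of_notMem (big x).2]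
      omega
  · intro d
    have : ∀ p : Fin 2 →₀ ℕ, Finite {x : Obj ℓ (A3 ℓ) // wt x = p} := fin_wt
    have hf := fin_wt (ℓ := ℓ) (A := A3 ℓ) (d - Finsupp.single 1 1)
    refine Finite.of_injective (β := {x : Obj ℓ (A3 ℓ) // wt x = d - Finsupp.single 1 1})
      (fun x => ⟨x.1.2, by have := x.2; exact (eq_tsub_of_add_eq ((add_comm _ _).trans this))⟩) ?_
    rintro ⟨⟨_, x⟩, hx⟩ ⟨⟨_, y⟩, hy⟩ h
    simp at h
    subst h
    rfl

theorem pair_eq {α : Type} [DecidableEq α] {a b c d : α} (h : ({a, b} : Finset α) = {c, d}) :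
    (a = c ∧ b = d) ∨ (a = d ∧ b = c) := by
  have h1 : a ∈ ({c, d} : Finset α) := by rw [← h]; simp
  have h2 : b ∈ ({c, d} : Finset α) := by rw [← h]; simp
  have h3 : c ∈ ({a, b} : Finset α) := by rw [h]; simp
  have h4 : d ∈ ({a, b} : Finset α) := by rw [h]; simp
  simp only [Finset.mem_insert, Finset.mem_singleton] at h1 h2 h3 h4
  grind

theorem pair_eq_lt {n : ℕ} {a b c d : Fin n} (h : ({a, b} : Finset (Fin n)) = {c, d})
    (h1 : a < b) (h2 : c < d) : a = c ∧ b = d := by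
  rcases pair_eq h with h | ⟨rfl, rfl⟩
  · exact h
  · exact absurd h1 (not_lt.2 h2.le)

theorem cyc_val {n : ℕ} (x : Fin (n + 2)) :
    (cyc x).val = if x.val = n + 1 then 0 else x.val + 1 := by
  have := x.2
  simp only [cyc]
  split_ifs with h
  · rw [h]; simp
  · exact Nat.mod_eq_of_lt (by omega)

theorem isSide_iff {n : ℕ} {x y : Fin (n + 2)} (h : x < y) :
    IsSide (n + 2) {x, y} ↔ y.val = x.val + 1 ∨ (x.val = 0 ∧ y.val = n + 1) := by
  have hx := x.2
  have hy := y.2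
  have h' : x.val < y.val := h
  constructor
  · rintro ⟨i, -, h2⟩
    have hc := cyc_val i
    rcases pair_eq h2 with ⟨rfl, rfl⟩ | ⟨rfl, rfl⟩ <;> split_ifs at hc <;> omega
  · rintro (h1 | h1)
    · have e : cyc x = y := by
        apply Fin.ext
        rw [cyc_val]
        split_ifs <;> omega
      exact ⟨x, by rw [e]; exact h.ne, by rw [e]⟩
    · have e : cyc y = x := by
        apply Fin.ext
        rw [cyc_val]
        split_ifs <;> omega
      exact ⟨y, by rw [e]; exact h.ne', by rw [e, Finset.pair_comm]⟩

theorem sub_val {n : ℕ} (x y : Fin (n + 2)) :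
    (y - x).val = if x.val ≤ y.val then y.val - x.val else n + 2 + y.val - x.val := by
  have hx := x.2
  have hy := y.2
  rw [Fin.val_sub]
  split_ifs with h
  · rw [show n + 2 - x.val + y.val = (y.val - x.val) + (n + 2) by omega, Nat.add_mod_right]
    exact Nat.mod_eq_of_lt (by omega)
  · rw [Nat.mod_eq_of_lt (by omega)]
    omega

theorem isNext_iff {n : ℕ} {c : Finset (Fin (n + 2))} {x y : Fin (n + 2)} :
    IsNext c x y ↔ x ∈ c ∧ y ∈ c ∧
      ((x.val < y.val ∧ ∀ z ∈ c, x.val < z.val → z.val < y.val → False) ∨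
       (y.val < x.val ∧ ∀ z ∈ c, y.val ≤ z.val ∧ z.val ≤ x.val)) := by
  have hx := x.2
  have hy := y.2
  constructor
  · rintro ⟨h1, h2, h3, h4⟩
    refine ⟨h1, h2, ?_⟩
    have h3' : y.val ≠ x.val := fun h => h3 (Fin.ext h)
    rcases Nat.lt_or_gt_of_ne h3' with h | h
    · right
      refine ⟨h, fun z hz => ?_⟩
      by_cases hzx : z = x
      · subst hzx; omega
      have := h4 z hz hzx
      have hz := z.2
      rw [sub_val, sub_val] at this
      split_ifs at this <;> omega
    · left
      refine ⟨h, fun z hz l1 l2 => ?_⟩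
      have := h4 z hz (fun e => by subst e; omega)
      rw [sub_val, sub_val] at this
      split_ifs at this <;> omega
  · rintro ⟨h1, h2, h3⟩
    refine ⟨h1, h2, fun e => by subst e; omega, fun z hz hzx => ?_⟩
    have hzx' : z.val ≠ x.val := fun h => hzx (Fin.ext h)
    have hz2 := z.2
    rw [sub_val, sub_val]
    rcases h3 with ⟨h3, h4⟩ | ⟨h3, h4⟩
    · have : ¬ (x.val < z.val ∧ z.val < y.val) := fun h => h4 z hz h.1 h.2
      split_ifs <;> omega
    · have := h4 z hz
      split_ifs <;> omega

structure Rel (n : ℕ) (S : Finset (Finset (Fin (n + 2)))) (T : Finset (ℕ × ℕ)) : Prop where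
  nc : NC (n + 1) T
  base : 1 ≤ n → (0, n + 1) ∈ T
  diag : ∀ e ∈ S, IsDiag (n + 2) e
  mem : ∀ x y : Fin (n + 2), x.val < y.val →
    ({x, y} ∈ S ↔ (x.val, y.val) ∈ T ∧ ¬ (x.val = 0 ∧ y.val = n + 1))

theorem arcT {n : ℕ} {S : Finset (Finset (Fin (n + 2)))} {T : Finset (ℕ × ℕ)} (r : Rel n S T)
    {x y : Fin (n + 2)} (h : x.val + 2 ≤ y.val) (h' : IsSide (n + 2) {x, y} ∨ {x, y} ∈ S) :
    (x.val, y.val) ∈ T := by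
  have hlt : x.val < y.val := by omega
  rcases h' with h' | h'
  · rw [isSide_iff hlt] at h'
    have hh : x.val = 0 ∧ y.val = n + 1 := by omega
    rw [hh.1, hh.2]
    exact r.base (by omega)
  · exact ((r.mem x y hlt).1 h').1

theorem arcT' {n : ℕ} {S : Finset (Finset (Fin (n + 2)))} {T : Finset (ℕ × ℕ)} (r : Rel n S T)
    {x y : Fin (n + 2)} (h : (x.val, y.val) ∈ T) : IsSide (n + 2) {x, y} ∨ {x, y} ∈ S := by
  have := r.nc.1 _ _ h
  have hlt : x.val < y.val := by omega
  by_cases hb : x.val = 0 ∧ y.val = n + 1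
  · left
    rw [isSide_iff hlt]
    exact Or.inr hb
  · right
    exact (r.mem x y hlt).2 ⟨h, hb⟩

theorem consec {n : ℕ} (c : Finset (Fin (n + 2))) (v : ℕ) (hv : ∀ x ∈ c, x.val ≠ v)
    {x0 y0 : Fin (n + 2)} (hx0 : x0 ∈ c) (hy0 : y0 ∈ c) (h1 : x0.val < v) (h2 : v < y0.val) :
    ∃ x y, x ∈ c ∧ y ∈ c ∧ x.val < v ∧ v < y.val ∧
      ∀ z ∈ c, x.val < z.val → z.val < y.val → False := by
  obtain ⟨x, hx, hxm⟩ := (c.filter (fun z => z.val < v)).exists_max_image (fun z => z.val)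
    ⟨x0, by simp [hx0, h1]⟩
  obtain ⟨y, hy, hym⟩ := (c.filter (fun z => v < z.val)).exists_min_image (fun z => z.val)
    ⟨y0, by simp [hy0, h2]⟩
  simp only [Finset.mem_filter] at hx hy hxm hym
  refine ⟨x, y, hx.1, hy.1, hx.2, hy.2, fun z hz l1 l2 => ?_⟩
  rcases Nat.lt_or_gt_of_ne (hv z hz) with h | h
  · have := hxm z ⟨hz, h⟩
    omega
  · have := hym z ⟨hz, h⟩
    omega

def cellF (n : ℕ) (T : Finset (ℕ × ℕ)) (e : ℕ × ℕ) : Finset (Fin (n + 2)) :=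
  Finset.univ.filter (fun x => x.val ∈ unc (sub T e.1 e.2) e.1 e.2)

theorem mem_cellF {n : ℕ} {T : Finset (ℕ × ℕ)} {i j : ℕ} {x : Fin (n + 2)} :
    x ∈ cellF n T (i, j) ↔ x.val ∈ unc (sub T i j) i j := by
  simp [cellF]

theorem card_cellF {n : ℕ} {T : Finset (ℕ × ℕ)} {i j : ℕ} (hj : j ≤ n + 1) :
    (cellF n T (i, j)).card = (unc (sub T i j) i j).card := by
  rw [← Finset.card_image_of_injective (cellF n T (i, j)) Fin.val_injective]
  congr 1
  ext v
  simp only [Finset.mem_image, mem_cellF]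
  constructor
  · rintro ⟨x, hx, rfl⟩
    exact hx
  · intro h
    have := mem_unc.1 h
    exact ⟨⟨v, by omega⟩, h, rfl⟩

theorem left_mem {T : Finset (ℕ × ℕ)} {i j : ℕ} (h : i ≤ j) : i ∈ unc (sub T i j) i j :=
  mem_unc.2 ⟨le_rfl, h, fun a b hab l => by have := mem_sub.1 hab; omega⟩

theorem right_mem {T : Finset (ℕ × ℕ)} {i j : ℕ} (h : i ≤ j) : j ∈ unc (sub T i j) i j :=
  mem_unc.2 ⟨h, le_rfl, fun a b hab l l' => by have := mem_sub.1 hab; omega⟩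

theorem isCell_of {n : ℕ} {S : Finset (Finset (Fin (n + 2)))} {T : Finset (ℕ × ℕ)}
    (r : Rel n S T) {i j : ℕ} (hij : (i, j) ∈ T) : IsCell (n + 2) S (cellF n T (i, j)) := by
  have l := r.nc.1 _ _ hij
  have hg : ∀ {x y : ℕ}, x ∈ unc (sub T i j) i j → y ∈ unc (sub T i j) i j → x + 2 ≤ y →
      (∀ v ∈ unc (sub T i j) i j, x < v → v < y → False) → (x, y) ∈ sub T i j :=
    fun hx hy hxy hb => gap (NX_sub r.nc.2 i j) hx hy hxy hb
  refine ⟨?_, ?_, ?_⟩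
  · rw [card_cellF l.2]
    have : ∃ v ∈ unc (sub T i j) i j, i < v ∧ v < j := by
      by_contra hcon
      push Not at hcon
      have := mem_sub.1 (hg (left_mem (by omega)) (right_mem (by omega)) l.1
        (fun v hv h1 h2 => by have := hcon v hv h1; omega))
      omega
    obtain ⟨v, hv, h1, h2⟩ := this
    have hs : ({i, v, j} : Finset ℕ) ⊆ unc (sub T i j) i j := by
      intro u hu
      simp only [Finset.mem_insert, Finset.mem_singleton] at hu
      rcases hu with rfl | rfl | rfl
      · exact left_mem (by omega)
      · exact hv
      · exact right_mem (by omega)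
    have := Finset.card_le_card hs
    rwa [Finset.card_eq_three.2 ⟨i, v, j, by omega, by omega, by omega, rfl⟩] at this
  · intro x y hxy
    rw [isNext_iff] at hxy
    obtain ⟨hx, hy, ⟨h1, h2⟩ | ⟨h1, h2⟩⟩ := hxy
    · by_cases h3 : y.val = x.val + 1
      · left
        rw [isSide_iff h1]
        exact Or.inl h3
      · apply arcT' r
        refine (mem_sub.1 (hg (mem_cellF.1 hx) (mem_cellF.1 hy) (by omega) ?_)).1
        intro v hv l1 l2
        have := mem_unc.1 hv
        exact h2 ⟨v, by omega⟩ (mem_cellF.2 hv) l1 l2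
    · have hi := h2 ⟨i, by omega⟩ (mem_cellF.2 (left_mem (by omega)))
      have hj := h2 ⟨j, by omega⟩ (mem_cellF.2 (right_mem (by omega)))
      dsimp only at hi hj
      have := mem_unc.1 (mem_cellF.1 hx)
      have := mem_unc.1 (mem_cellF.1 hy)
      rw [Finset.pair_comm]
      apply arcT' r
      rwa [show y.val = i by omega, show x.val = j by omega]
  · intro e he hec
    obtain ⟨x, y, hne, rfl⟩ := Finset.card_eq_two.1 (r.diag e he).1
    have hx : x ∈ cellF n T (i, j) := hec (by simp)
    have hy : y ∈ cellF n T (i, j) := hec (by simp)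
    have main : ∀ x y : Fin (n + 2), x ∈ cellF n T (i, j) → y ∈ cellF n T (i, j) →
        x.val < y.val → {x, y} ∈ S → IsNext (cellF n T (i, j)) x y ∨ IsNext (cellF n T (i, j)) y x := by
      intro x y hx hy hlt hS
      have hT := ((r.mem x y hlt).1 hS).1
      have hx' := mem_unc.1 (mem_cellF.1 hx)
      have hy' := mem_unc.1 (mem_cellF.1 hy)
      by_cases hb : x.val = i ∧ y.val = j
      · right
        rw [isNext_iff]
        refine ⟨hy, hx, Or.inr ⟨hlt, fun z hz => ?_⟩⟩
        have := mem_unc.1 (mem_cellF.1 hz)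
        omega
      · left
        rw [isNext_iff]
        refine ⟨hx, hy, Or.inl ⟨hlt, fun z hz l1 l2 => ?_⟩⟩
        have := mem_unc.1 (mem_cellF.1 hz)
        exact this.2.2 _ _ (mem_sub.2 ⟨hT, hx'.1, hy'.2.1, hb⟩) l1 l2
    have hne' : x.val ≠ y.val := fun h => hne (Fin.ext h)
    rcases Nat.lt_or_gt_of_ne hne' with h | h
    · exact ⟨x, y, rfl, main x y hx hy h he⟩
    · exact ⟨y, x, Finset.pair_comm _ _, main y x hy hx h (by rwa [Finset.pair_comm])⟩

theorem of_isCell {n : ℕ} {S : Finset (Finset (Fin (n + 2)))} {T : Finset (ℕ × ℕ)}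
    (r : Rel n S T) {c : Finset (Fin (n + 2))} (hc : IsCell (n + 2) S c) :
    ∃ e ∈ T, cellF n T e = c := by
  obtain ⟨h3, hE, hI⟩ := hc
  have hne : c.Nonempty := Finset.card_pos.1 (by omega)
  obtain ⟨i, hi, him⟩ := c.exists_min_image (fun z => z.val) hne
  obtain ⟨j, hj, hjm⟩ := c.exists_max_image (fun z => z.val) hne
  have hij : i.val + 2 ≤ j.val := by
    have hs : c ⊆ Finset.Icc i j := fun z hz => Finset.mem_Icc.2 ⟨him z hz, hjm z hz⟩
    have := Finset.card_le_card hs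
    rw [Fin.card_Icc] at this
    omega
  have hex : ∃ z ∈ c, i.val < z.val ∧ z.val < j.val := by
    by_contra hcon
    push Not at hcon
    have hs : c ⊆ {i, j} := by
      intro z hz
      have h1 := him z hz
      have h2 := hjm z hz
      have h3 := hcon z hz
      simp only [Finset.mem_insert, Finset.mem_singleton, Fin.ext_iff]
      omega
    have := (Finset.card_le_card hs).trans Finset.card_le_two
    omega
  have hb : (i.val, j.val) ∈ T := by
    apply arcT r hij
    rw [Finset.pair_comm]
    apply hE
    rw [isNext_iff]
    exact ⟨hj, hi, Or.inr ⟨by omega, fun z hz => ⟨him z hz, hjm z hz⟩⟩⟩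
  have hN : ∀ x y, x ∈ c → y ∈ c → x.val + 2 ≤ y.val →
      (∀ z ∈ c, x.val < z.val → z.val < y.val → False) → (x.val, y.val) ∈ T := by
    intro x y hx hy hxy hz
    exact arcT r hxy (hE x y (isNext_iff.2 ⟨hx, hy, Or.inl ⟨by omega, hz⟩⟩))
  refine ⟨(i.val, j.val), hb, ?_⟩
  ext v
  rw [mem_cellF, mem_unc]
  constructor
  · rintro ⟨h1, h2, h3⟩
    by_contra hv
    have hv' : ∀ x ∈ c, x.val ≠ v.val := fun x hx h => hv (Fin.ext h ▸ hx)
    have := hv' i hi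
    have := hv' j hj
    obtain ⟨x, y, hx, hy, l1, l2, hz⟩ := consec c v.val hv' hi hj (by omega) (by omega)
    have hxy := hN x y hx hy (by omega) hz
    refine h3 _ _ (mem_sub.2 ⟨hxy, him x hx, hjm y hy, ?_⟩) l1 l2
    rintro ⟨e1, e2⟩
    obtain ⟨z, hzc, z1, z2⟩ := hex
    exact hz z hzc (by omega) (by omega)
  · intro hv
    refine ⟨him v hv, hjm v hv, ?_⟩
    intro p q hpq l1 l2
    rw [mem_sub] at hpq
    obtain ⟨hpq, g1, g2, g3⟩ := hpq
    have hjn := j.2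
    by_cases hp : ∀ x ∈ c, x.val ≠ p
    · have := hp i hi
      obtain ⟨x, y, hx, hy, k1, k2, hz⟩ := consec c p hp hi hv (by omega) l1
      have hyv : y.val ≤ v.val := by
        by_contra hcon
        exact hz v hv (by omega) (by omega)
      exact r.nc.2 _ _ _ _ (hN x y hx hy (by omega) hz) hpq k1 k2 (by omega)
    by_cases hq : ∀ x ∈ c, x.val ≠ q
    · have := hq j hj
      obtain ⟨x, y, hx, hy, k1, k2, hz⟩ := consec c q hq hv hj l2 (by omega)
      have hyv : v.val ≤ x.val := by
        by_contra hcon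
        exact hz v hv (by omega) (by omega)
      exact r.nc.2 _ _ _ _ hpq (hN x y hx hy (by omega) hz) (by omega) k1 k2
    push Not at hp hq
    obtain ⟨x, hx, rfl⟩ := hp
    obtain ⟨y, hy, rfl⟩ := hq
    have hi2 := him x hx
    have hS : {x, y} ∈ S := (r.mem x y (by omega)).2 ⟨hpq, by omega⟩
    obtain ⟨x', y', he, hn⟩ := hI _ hS (by
      intro z hz
      simp only [Finset.mem_insert, Finset.mem_singleton] at hz
      rcases hz with rfl | rfl <;> assumption)
    have hn' : IsNext c x y ∨ IsNext c y x := by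
      rcases pair_eq he with ⟨rfl, rfl⟩ | ⟨rfl, rfl⟩
      · exact hn
      · exact hn.symm
    rw [isNext_iff, isNext_iff] at hn'
    rcases hn' with ⟨-, -, ⟨_, hz⟩ | ⟨_, hz⟩⟩ | ⟨-, -, ⟨_, hz⟩ | ⟨_, hz⟩⟩
    · exact hz v hv l1 l2
    · omega
    · omega
    · have := hz i hi
      have := hz j hj
      omega

theorem isCell_iff {n : ℕ} {S : Finset (Finset (Fin (n + 2)))} {T : Finset (ℕ × ℕ)}
    (r : Rel n S T) (c : Finset (Fin (n + 2))) :
    IsCell (n + 2) S c ↔ ∃ e ∈ T, cellF n T e = c := by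
  constructor
  · exact of_isCell r
  · rintro ⟨⟨i, j⟩, he, rfl⟩
    exact isCell_of r he

theorem numCells_eq {n : ℕ} {S : Finset (Finset (Fin (n + 2)))} {T : Finset (ℕ × ℕ)}
    (r : Rel n S T) : numCells (n + 2) S = T.card := by
  have : {c : Finset (Fin (n + 2)) | IsCell (n + 2) S c} = ↑(T.image (cellF n T)) := by
    ext c
    simp only [Finset.coe_image, Set.mem_image, Finset.mem_coe]
    exact isCell_iff r c
  rw [numCells, this, Set.ncard_coe_finset, Finset.card_image_of_injOn]
  rintro ⟨i, j⟩ h ⟨i', j'⟩ h' he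
  have l := r.nc.1 _ _ h
  have l' := r.nc.1 _ _ h'
  have a1 : (⟨i, by omega⟩ : Fin (n + 2)) ∈ cellF n T (i', j') := by
    rw [← he, mem_cellF]; exact left_mem (by omega)
  have a2 : (⟨j, by omega⟩ : Fin (n + 2)) ∈ cellF n T (i', j') := by
    rw [← he, mem_cellF]; exact right_mem (by omega)
  have a3 : (⟨i', by omega⟩ : Fin (n + 2)) ∈ cellF n T (i, j) := by
    rw [he, mem_cellF]; exact left_mem (by omega)
  have a4 : (⟨j', by omega⟩ : Fin (n + 2)) ∈ cellF n T (i, j) := by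
    rw [he, mem_cellF]; exact right_mem (by omega)
  rw [mem_cellF, mem_unc] at a1 a2 a3 a4
  dsimp only at a1 a2 a3 a4
  rw [Prod.mk.injEq]
  omega

theorem OK_iff {ℓ n : ℕ} {S : Finset (Finset (Fin (n + 2)))} {T : Finset (ℕ × ℕ)}
    (r : Rel n S T) :
    (∀ c : Finset (Fin (n + 2)), IsCell (n + 2) S c → c.card % ℓ = 3 % ℓ) ↔ OK ℓ T := by
  constructor
  · intro h i j hij
    rw [← card_cellF (r.nc.1 _ _ hij).2]
    exact h _ (isCell_of r hij)
  · intro h c hc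
    obtain ⟨⟨i, j⟩, he, rfl⟩ := of_isCell r hc
    rw [card_cellF (r.nc.1 _ _ he).2]
    exact h i j he

theorem Rel.diss {n : ℕ} {S : Finset (Finset (Fin (n + 2)))} {T : Finset (ℕ × ℕ)}
    (r : Rel n S T) : IsDissection (n + 2) S := by
  refine ⟨r.diag, ?_⟩
  rintro e he f hf ⟨a, b, c, d, h1, h2, h3, h⟩
  have h1 : a.val < c.val := h1
  have h2 : c.val < b.val := h2
  have h3 : b.val < d.val := h3
  have main : {a, b} ∈ S → {c, d} ∈ S → False := by
    intro g1 g2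
    exact r.nc.2 _ _ _ _ ((r.mem a b (by omega)).1 g1).1 ((r.mem c d (by omega)).1 g2).1 h1 h2 h3
  rcases h with ⟨rfl, rfl⟩ | ⟨rfl, rfl⟩
  · exact main he hf
  · exact main hf he

theorem Rel.unique {n : ℕ} {S : Finset (Finset (Fin (n + 2)))} {T T' : Finset (ℕ × ℕ)}
    (r : Rel n S T) (r' : Rel n S T') : T = T' := by
  have main : ∀ T T', Rel n S T → Rel n S T' → T ⊆ T' := by
    rintro T T' r r' ⟨i, j⟩ h
    have l := r.nc.1 _ _ h
    by_cases hb : i = 0 ∧ j = n + 1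
    · rw [hb.1, hb.2]
      exact r'.base (by omega)
    · have := (r.mem ⟨i, by omega⟩ ⟨j, by omega⟩ (by dsimp only; omega)).2 ⟨h, hb⟩
      exact ((r'.mem _ _ (by dsimp only; omega)).1 this).1
  exact Finset.Subset.antisymm (main _ _ r r') (main _ _ r' r)

theorem Rel.unique' {n : ℕ} {S S' : Finset (Finset (Fin (n + 2)))} {T : Finset (ℕ × ℕ)}
    (r : Rel n S T) (r' : Rel n S' T) : S = S' := by
  have main : ∀ S S', Rel n S T → Rel n S' T → S ⊆ S' := by
    intro S S' r r' e he
    obtain ⟨x, y, hne, rfl⟩ := Finset.card_eq_two.1 (r.diag e he).1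
    have hne' : x.val ≠ y.val := fun h => hne (Fin.ext h)
    rcases Nat.lt_or_gt_of_ne hne' with h | h
    · exact (r'.mem x y h).2 ((r.mem x y h).1 he)
    · rw [Finset.pair_comm] at he ⊢
      exact (r'.mem y x h).2 ((r.mem y x h).1 he)
  exact Finset.Subset.antisymm (main _ _ r r') (main _ _ r' r)

theorem exists_S {n : ℕ} {T : Finset (ℕ × ℕ)} (hT : NC (n + 1) T)
    (hb : 1 ≤ n → (0, n + 1) ∈ T) : ∃ S, Rel n S T := by
  classical
  refine ⟨Finset.univ.filter (fun e => ∃ x y : Fin (n + 2), x.val < y.val ∧ e = {x, y} ∧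
    (x.val, y.val) ∈ T ∧ ¬ (x.val = 0 ∧ y.val = n + 1)), hT, hb, ?_, ?_⟩
  · intro e he
    simp only [Finset.mem_filter, Finset.mem_univ, true_and] at he
    obtain ⟨x, y, h1, rfl, h2, h3⟩ := he
    have := hT.1 _ _ h2
    refine ⟨Finset.card_pair (fun h => by subst h; omega), ?_⟩
    rw [isSide_iff h1]
    omega
  · intro x y hxy
    simp only [Finset.mem_filter, Finset.mem_univ, true_and]
    constructor
    · rintro ⟨x', y', h1, h2, h3⟩
      obtain ⟨rfl, rfl⟩ := pair_eq_lt h2 hxy h1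
      exact h3
    · intro h
      exact ⟨x, y, hxy, rfl, h⟩

theorem exists_T {n : ℕ} {S : Finset (Finset (Fin (n + 2)))} (hS : IsDissection (n + 2) S) :
    ∃ T, Rel n S T := by
  classical
  let T := (Finset.range (n + 2) ×ˢ Finset.range (n + 2)).filter (fun e =>
    (∃ x y : Fin (n + 2), x.val < y.val ∧ e = (x.val, y.val) ∧ {x, y} ∈ S) ∨
      (1 ≤ n ∧ e = (0, n + 1)))
  have hT : ∀ i j, (i, j) ∈ T ↔
      (∃ x y : Fin (n + 2), x.val < y.val ∧ i = x.val ∧ j = y.val ∧ {x, y} ∈ S) ∨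
      (1 ≤ n ∧ i = 0 ∧ j = n + 1) := by
    intro i j
    simp only [T, Finset.mem_filter, Finset.mem_product, Finset.mem_range, Prod.mk.injEq, and_assoc]
    constructor
    · rintro ⟨-, -, h⟩
      exact h
    · intro h
      refine ⟨?_, ?_, h⟩
      · rcases h with ⟨x, y, h1, rfl, rfl, -⟩ | h
        · exact x.2
        · omega
      · rcases h with ⟨x, y, h1, rfl, rfl, -⟩ | h
        · exact y.2
        · omega
  have hd : ∀ x y : Fin (n + 2), x.val < y.val → {x, y} ∈ S →
      x.val + 2 ≤ y.val ∧ ¬ (x.val = 0 ∧ y.val = n + 1) := by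
    intro x y hxy h
    have := (hS.1 _ h).2
    rw [isSide_iff hxy] at this
    omega
  refine ⟨T, ⟨?_, ?_⟩, ?_, hS.1, ?_⟩
  · intro i j h
    rcases (hT i j).1 h with ⟨x, y, h1, rfl, rfl, h2⟩ | h
    · have := hd x y h1 h2
      have := y.2
      omega
    · omega
  · intro a b c d h1 h2 l1 l2 l3
    rcases (hT _ _).1 h1 with ⟨x, y, g1, rfl, rfl, g2⟩ | h1
    · rcases (hT _ _).1 h2 with ⟨x', y', g1', rfl, rfl, g2'⟩ | h2
      · exact hS.2 _ g2 _ g2' ⟨x, y, x', y', l1, l2, l3, Or.inl ⟨rfl, rfl⟩⟩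
      · omega
    · rcases (hT _ _).1 h2 with ⟨x', y', g1', rfl, rfl, g2'⟩ | h2
      · have := y'.2
        omega
      · omega
  · intro h
    exact (hT _ _).2 (Or.inr ⟨h, rfl, rfl⟩)
  · intro x y hxy
    rw [hT]
    constructor
    · intro h
      exact ⟨Or.inl ⟨x, y, hxy, rfl, rfl, h⟩, (hd x y hxy h).2⟩
    · rintro ⟨⟨x', y', h1, h2, h3, h4⟩ | h, h'⟩
      · rw [Fin.ext h2, Fin.ext h3]
        exact h4
      · omega

theorem Lnm_eq (ℓ n m : ℕ) (d : Fin 2 →₀ ℕ) (h0 : d 0 = n + 1) (h1 : d 1 = m) :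
    Lnm ℓ n m = Nat.card {x : Obj ℓ {2} // wt x = d} := by
  rw [Lnm, ← Nat.card_coe_set_eq]
  symm
  have key : ∀ x : {x : Obj ℓ {2} // wt x = d}, ∃ S, Rel n S x.1.1.2 := by
    rintro ⟨⟨⟨k, T⟩, hT, hO, hc⟩, hw⟩
    have hw := (wt_eq _ _).1 hw
    dsimp only at hw hT hc ⊢
    have : k = n + 1 := by omega
    subst this
    apply exists_S hT
    intro hn
    rcases (unc_two' hT).1 hc with h | h
    · omega
    · exact h
  choose f hf using key
  refine Nat.card_congr (Equiv.ofBijective (fun x => ⟨f x, (hf x).diss, (OK_iff (hf x)).2 x.1.2.2.1, ?_⟩) ⟨?_, ?_⟩)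
  · rw [numCells_eq (hf x), ← h1]
    exact ((wt_eq _ _).1 x.2).2
  · intro x y hxy
    have hxy : f x = f y := congrArg Subtype.val hxy
    have h2 := (hf x).unique (hxy ▸ hf y)
    have h3 := ((wt_eq _ _).1 x.2).1.trans ((wt_eq _ _).1 y.2).1.symm
    exact Subtype.ext (Subtype.ext (Prod.ext h3 h2))
  · rintro ⟨S, hS, hO, hm⟩
    obtain ⟨T, r⟩ := exists_T hS
    have hc : (unc T 0 (n + 1)).card = 2 := by
      rw [unc_two' r.nc]
      by_cases hn : 1 ≤ n
      · exact Or.inr (r.base hn)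
      · left; omega
    rw [numCells_eq r] at hm
    refine ⟨⟨⟨(n + 1, T), r.nc, (OK_iff r).1 hO, hc⟩, ?_⟩, ?_⟩
    · exact (wt_eq _ _).2 ⟨h0.symm, hm.trans h1.symm⟩
    · apply Subtype.ext
      exact (hf _).unique' r

theorem gf_two_eq (ℓ : ℕ) : gf (wt (ℓ := ℓ) (A := {2})) = MvPowerSeries.X 0 * Lgf ℓ := by
  ext d
  rw [MvPowerSeries.X, MvPowerSeries.coeff_monomial_mul, coeff_gf]
  split_ifs with h
  · have h0 : 1 ≤ d 0 := by simpa using h 0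
    rw [one_mul]
    change _ = (Lnm ℓ ((d - Finsupp.single 0 1 : Fin 2 →₀ ℕ) 0)
      ((d - Finsupp.single 0 1 : Fin 2 →₀ ℕ) 1) : ℚ)
    rw [← Lnm_eq ℓ _ _ d]
    · simp
      omega
    · simp
  · have h0 : d 0 = 0 := by
      by_contra h0
      apply h
      intro i
      fin_cases i
      · simp; omega
      · simp
    have : IsEmpty {x : Obj ℓ {2} // wt x = d} := by
      refine ⟨fun x => ?_⟩
      have hw := ((wt_eq _ _).1 x.2).1
      have := pos_of_card (le_of_eq (Eq.symm x.1.2.2.2))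
      omega
    simp

/-- The generating function of `ℓ`-periodic dissections satisfies
`L = 1 + w z L^2 / (1 - z^ℓ L^ℓ)`, i.e. `L (1 - z^ℓ L^ℓ) = (1 - z^ℓ L^ℓ) + w z L^2`. -/
theorem ell_periodic_gf_functional_equation (ℓ : ℕ) (hℓ : 1 ≤ ℓ) :
    Lgf ℓ * (1 - MvPowerSeries.X (0 : Fin 2) ^ ℓ * Lgf ℓ ^ ℓ) =
      (1 - MvPowerSeries.X (0 : Fin 2) ^ ℓ * Lgf ℓ ^ ℓ) +
        MvPowerSeries.X (1 : Fin 2) * MvPowerSeries.X (0 : Fin 2) * Lgf ℓ ^ 2 := by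
  have h1 := gf_two ℓ
  have h2 := gf_A3 ℓ hℓ
  rw [gf_two_eq] at h1 h2
  have hX : (MvPowerSeries.X (0 : Fin 2) : MvPowerSeries (Fin 2) ℚ) ≠ 0 := by
    intro h
    have := congrArg (MvPowerSeries.coeff (Finsupp.single (0 : Fin 2) 1)) h
    simp [MvPowerSeries.coeff_X] at this
  apply mul_left_cancel₀ hX
  rw [mul_pow] at h2
  generalize gf (wt (ℓ := ℓ) (A := A3 ℓ)) = H at h1 h2
  linear_combination (1 - MvPowerSeries.X (0 : Fin 2) ^ ℓ * Lgf ℓ ^ ℓ) * h1 +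
    MvPowerSeries.X (1 : Fin 2) * h2

end PolygonDissection
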